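/- arXiv:2406.02493 — 2 statements merged into one kernel-verified Lean document; each statement's English description precedes it below -/
import Mathlib

section
/- Let a ≥ 2 and let t ≥ 3 be odd, and let F = F̆(a,a,…,a) (t copies of a) with n = #F = ta − 1. Then the order ideal cardinality statistic χ̂ := Σ_{p ∈ F} χ̂_p satisfies χ̂ ≡ n/2 + a·(Σ_{p a peak of F} χ_p − Σ_{v a valley of F} χ_v), i.e. the difference of the two sides lies in the ℝ-span of the toggleability statistics {T_p : p ∈ F}. -/
open scoped Classical

namespace Fence

/-- partial sums: `m α i = α 0 + ⋯ + α (i-1)` (the paper's `m_i`). -/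
def m (α : ℕ → ℕ) (i : ℕ) : ℕ := ∑ k ∈ Finset.range i, α k

/-- the number `n` of elements of the fence `F̆(α)`. -/
def nn (t : ℕ) (α : ℕ → ℕ) : ℕ := m α t - 1

/-- vertex type: index `0` is a dummy (used as sentinel for nonexistent elements);
the fence elements are the indices `1,…,nn t α`. -/
abbrev V (t : ℕ) (α : ℕ → ℕ) := Fin (nn t α + 1)

/-- the element `x_j` (1-based). -/
def xel (t : ℕ) (α : ℕ → ℕ) (j : ℕ) : V t α :=
  ⟨j % (nn t α + 1), Nat.mod_lt _ (Nat.succ_pos _)⟩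

/-- `p` is an actual element of the fence (not the dummy `0`). -/
def Elem (t : ℕ) (α : ℕ → ℕ) (p : V t α) : Prop := 1 ≤ (p : ℕ)

/-- the conditions on `(t, α)` for `F̆(α)` to be a fence. -/
def IsFence (t : ℕ) (α : ℕ → ℕ) : Prop :=
  2 ≤ t ∧ (∀ i < t, 1 ≤ α i) ∧ 2 ≤ α 0 ∧ 2 ≤ α (t - 1)

/-- the covering relation of the fence: `Cov t α a b` means `a ⋖ b`. -/
def Cov (t : ℕ) (α : ℕ → ℕ) (a b : V t α) : Prop :=
  ∃ i < t, ((i % 2 = 0 ∧ (b : ℕ) = (a : ℕ) + 1) ∨ (i % 2 = 1 ∧ (a : ℕ) = (b : ℕ) + 1)) ∧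
    m α i ≤ min (a : ℕ) (b : ℕ) ∧ min (a : ℕ) (b : ℕ) < m α (i + 1) ∧
    1 ≤ min (a : ℕ) (b : ℕ) ∧ max (a : ℕ) (b : ℕ) ≤ nn t α

/-- the order of the fence: reflexive–transitive closure of the covering relation. -/
def Le (t : ℕ) (α : ℕ → ℕ) : V t α → V t α → Prop := Relation.ReflTransGen (Cov t α)

/-- order ideals of the fence (as sets of actual elements, downward closed). -/
def IsIdeal (t : ℕ) (α : ℕ → ℕ) (I : Set (V t α)) : Prop :=
  (∀ p ∈ I, Elem t α p) ∧ ∀ a b : V t α, Le t α a b → b ∈ I → a ∈ I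

/-- `J t α` is the set of order ideals of the fence. -/
abbrev J (t : ℕ) (α : ℕ → ℕ) := {I : Set (V t α) // IsIdeal t α I}

/-- `p` is a maximal element of the set `I`. -/
def MaxIn (t : ℕ) (α : ℕ → ℕ) (I : Set (V t α)) (p : V t α) : Prop :=
  p ∈ I ∧ ∀ q ∈ I, Le t α p q → q = p

/-- `p` is a minimal element of the complement of `I` (among actual elements). -/
def MinOut (t : ℕ) (α : ℕ → ℕ) (I : Set (V t α)) (p : V t α) : Prop :=
  Elem t α p ∧ p ∉ I ∧ ∀ q : V t α, Elem t α q → q ∉ I → Le t α q p → q = p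

/-- the order-ideal indicator function `χ̂_p`. -/
noncomputable def chiHat (t : ℕ) (α : ℕ → ℕ) (p : V t α) (I : J t α) : ℝ :=
  if p ∈ I.1 then 1 else 0

/-- the antichain indicator function `χ_p`. -/
noncomputable def chi (t : ℕ) (α : ℕ → ℕ) (p : V t α) (I : J t α) : ℝ :=
  if MaxIn t α I.1 p then 1 else 0

/-- the toggleability statistic `T_p`. -/
noncomputable def Tg (t : ℕ) (α : ℕ → ℕ) (p : V t α) (I : J t α) : ℝ :=
  if MinOut t α I.1 p then 1 else if MaxIn t α I.1 p then -1 else 0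

/-- the antichain toggleability statistic `T_A`. -/
noncomputable def TA (t : ℕ) (α : ℕ → ℕ) (A : Set (V t α)) (I : J t α) : ℝ :=
  if ∀ p ∈ A, MinOut t α I.1 p then 1 else if ∀ p ∈ A, MaxIn t α I.1 p then -1 else 0

/-- `#[a,b]`: the number of elements `r` with `a ⊴ r ⊴ b`. -/
noncomputable def icard (t : ℕ) (α : ℕ → ℕ) (a b : V t α) : ℕ :=
  Set.ncard {r : V t α | Elem t α r ∧ Le t α a r ∧ Le t α r b}

/-- the span of the toggleability statistics `{T_p : p ∈ F}`. -/
noncomputable def ToggSpan (t : ℕ) (α : ℕ → ℕ) : Submodule ℝ (J t α → ℝ) :=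
  Submodule.span ℝ {f | ∃ p : V t α, Elem t α p ∧ f = Tg t α p}

/-- `f ≡ g`: `f - g` is an `ℝ`-linear combination of toggleability statistics. -/
def Equiv' (t : ℕ) (α : ℕ → ℕ) (f g : J t α → ℝ) : Prop := f - g ∈ ToggSpan t α

/-- statistics of the form `const + linear combination of toggleability statistics`. -/
noncomputable def ConstPlusTogg (t : ℕ) (α : ℕ → ℕ) : Submodule ℝ (J t α → ℝ) :=
  ToggSpan t α ⊔ Submodule.span ℝ {fun _ : J t α => (1 : ℝ)}

/-- the span of the antichain indicator functions `{χ_p : p ∈ F}`. -/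
noncomputable def chiSpan (t : ℕ) (α : ℕ → ℕ) : Submodule ℝ (J t α → ℝ) :=
  Submodule.span ℝ {f | ∃ p : V t α, Elem t α p ∧ f = chi t α p}

/-- the span of the order-ideal indicator functions `{χ̂_p : p ∈ F}`. -/
noncomputable def chiHatSpan (t : ℕ) (α : ℕ → ℕ) : Submodule ℝ (J t α → ℝ) :=
  Submodule.span ℝ {f | ∃ p : V t α, Elem t α p ∧ f = chiHat t α p}

/-- the antichain toggleability space `A_T(F)`. -/
noncomputable def AT (t : ℕ) (α : ℕ → ℕ) : Submodule ℝ (J t α → ℝ) :=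
  chiSpan t α ⊓ ConstPlusTogg t α

/-- the order ideal toggleability space `I_T(F)`. -/
noncomputable def IT (t : ℕ) (α : ℕ → ℕ) : Submodule ℝ (J t α → ℝ) :=
  chiHatSpan t α ⊓ ConstPlusTogg t α

/-- the shared element `s_i = x_{m_i}` (for `1 ≤ i ≤ t-1`); the sentinels `i = 0` and
`i = t` give the dummy vertex `0`, so statistics indexed by them vanish. -/
def sElx (t : ℕ) (α : ℕ → ℕ) (i : ℕ) : V t α := xel t α (m α i)

/-- 1-based index of the unshared element `s_{(i,j)}` (the `j`-th smallest unshared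
element of the segment `S_i`, in the order of the fence). -/
def uEl (α : ℕ → ℕ) (i j : ℕ) : ℕ :=
  if (i - 1) % 2 = 0 then m α (i - 1) + j else m α i - j

def uElx (t : ℕ) (α : ℕ → ℕ) (i j : ℕ) : V t α := xel t α (uEl α i j)

/-- 1-based index of the peak of segment `S_i` (sentinel `0` if it does not exist). -/
def peakN (t : ℕ) (α : ℕ → ℕ) (i : ℕ) : ℕ :=
  if i % 2 = 1 then (if i + 1 ≤ t then m α i else 0) else m α (i - 1)

/-- 1-based index of the valley of segment `S_i` (sentinel `0` if it does not exist). -/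
def valleyN (t : ℕ) (α : ℕ → ℕ) (i : ℕ) : ℕ :=
  if i % 2 = 1 then (if 2 ≤ i then m α (i - 1) else 0) else (if i + 1 ≤ t then m α i else 0)

def peakx (t : ℕ) (α : ℕ → ℕ) (i : ℕ) : V t α := xel t α (peakN t α i)
def valleyx (t : ℕ) (α : ℕ → ℕ) (i : ℕ) : V t α := xel t α (valleyN t α i)

/-- segment `S_i` has a peak. -/
def HasPeak (t i : ℕ) : Prop := i % 2 = 0 ∨ i + 1 ≤ t

/-- segment `S_i` has a valley. -/
def HasValley (t i : ℕ) : Prop := (i % 2 = 1 ∧ 2 ≤ i) ∨ (i % 2 = 0 ∧ i + 1 ≤ t)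

/-- `p` is a shared element of the fence. -/
def IsSharedElem (t : ℕ) (α : ℕ → ℕ) (p : V t α) : Prop :=
  ∃ i, 1 ≤ i ∧ i + 1 ≤ t ∧ p = sElx t α i

/-- `p` is a peak of the fence. -/
def IsPeakElem (t : ℕ) (α : ℕ → ℕ) (p : V t α) : Prop :=
  ∃ i, 1 ≤ i ∧ i + 1 ≤ t ∧ i % 2 = 1 ∧ p = sElx t α i

/-- span of the antichain indicators of the shared elements. -/
noncomputable def chiSharedSpan (t : ℕ) (α : ℕ → ℕ) : Submodule ℝ (J t α → ℝ) :=
  Submodule.span ℝ {f | ∃ i, 1 ≤ i ∧ i + 1 ≤ t ∧ f = chi t α (sElx t α i)}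

/-- span of the order-ideal indicators of the shared elements. -/
noncomputable def chiHatSharedSpan (t : ℕ) (α : ℕ → ℕ) : Submodule ℝ (J t α → ℝ) :=
  Submodule.span ℝ {f | ∃ i, 1 ≤ i ∧ i + 1 ≤ t ∧ f = chiHat t α (sElx t α i)}

theorem cov_elem {t : ℕ} {α : ℕ → ℕ} {a b : V t α} (h : Cov t α a b) :
    Elem t α a ∧ Elem t α b := by
  obtain ⟨i, hi, hd, h1, h2, h3, h4⟩ := h
  constructor <;> (simp only [Elem]; omega)

theorem le_elem {t : ℕ} {α : ℕ → ℕ} {a b : V t α} (h : Le t α a b) (hb : Elem t α b) :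
    Elem t α a := by
  induction h using Relation.ReflTransGen.head_induction_on with
  | refl => exact hb
  | head hc _ _ => exact (cov_elem hc).1

/-- rowmotion: `ρ(I)` is the order ideal generated by the minimal elements of the
complement of `I`. -/
noncomputable def rho (t : ℕ) (α : ℕ → ℕ) (I : J t α) : J t α :=
  ⟨{q | ∃ p : V t α, MinOut t α I.1 p ∧ Le t α q p}, by
    constructor
    · rintro q ⟨p, hp, hle⟩
      exact le_elem hle hp.1
    · rintro a b hab ⟨p, hp, hle⟩
      exact ⟨p, hp, Relation.ReflTransGen.trans hab hle⟩⟩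

/-- the (forward) orbit of `x` under `ρ`. -/
def orbit {X : Type*} (ρ : X → X) (x : X) : Set X := {y | ∃ k : ℕ, ρ^[k] x = y}

/-- `f` is `c`-mesic under `ρ`: the sum of `f` over each orbit is `c` times
the orbit size. -/
def IsMesic {X : Type*} (ρ : X → X) (f : X → ℝ) (c : ℝ) : Prop :=
  ∀ x : X, ∑ᶠ y ∈ orbit ρ x, f y = (orbit ρ x).ncard * c


lemma m_const (a i : ℕ) : m (fun _ => a) i = i * a := by simp [m]

lemma nn_const (a t : ℕ) (ha : 2 ≤ a) (ht : 3 ≤ t) : nn t (fun _ => a) + 1 = t * a := by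
  have : 0 < t * a := by positivity
  simp only [nn, m_const]; omega

lemma cov_iff (a t : ℕ) (ha : 2 ≤ a) (ht : 3 ≤ t) (p q : V t (fun _ => a)) :
    Cov t (fun _ => a) p q ↔ 1 ≤ (p : ℕ) ∧ 1 ≤ (q : ℕ) ∧
      (((q : ℕ) = p + 1 ∧ ((p : ℕ) / a) % 2 = 0) ∨ ((p : ℕ) = q + 1 ∧ ((q : ℕ) / a) % 2 = 1)) := by
  have hn := nn_const a t ha ht
  have hp := p.2
  have hq := q.2
  have ha0 : 0 < a := by omega
  unfold Cov
  constructor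
  · rintro ⟨i, hi, hd, h1, h2, h3, h4⟩
    rw [m_const] at h1 h2
    have hdiv : min (p : ℕ) q / a = i := by
      apply Nat.div_eq_of_lt_le
      · linarith
      · linarith
    refine ⟨by omega, by omega, ?_⟩
    rcases hd with ⟨h, h'⟩ | ⟨h, h'⟩
    · left
      have : min (p : ℕ) q = p := by omega
      rw [this] at hdiv
      exact ⟨h', by rw [hdiv]; exact h⟩
    · right
      have : min (p : ℕ) q = q := by omega
      rw [this] at hdiv
      exact ⟨h', by rw [hdiv]; exact h⟩
  · rintro ⟨h1, h2, h⟩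
    refine ⟨min (p : ℕ) q / a, ?_, ?_, ?_, ?_, by omega, by omega⟩
    · rw [Nat.div_lt_iff_lt_mul ha0]; omega
    · rcases h with ⟨h, h'⟩ | ⟨h, h'⟩
      · left
        have : min (p : ℕ) q = p := by omega
        rw [this]; exact ⟨h', h⟩
      · right
        have : min (p : ℕ) q = q := by omega
        rw [this]; exact ⟨h', h⟩
    · rw [m_const]; exact Nat.div_mul_le_self _ _
    · rw [m_const]; rw [add_mul, one_mul]; have := Nat.div_add_mod (min (p : ℕ) q) a; have := Nat.mod_lt (min (p : ℕ) q) ha0; nlinarith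

lemma maxIn_iff {t : ℕ} {α : ℕ → ℕ} (I : J t α) (hirr : ∀ p, ¬ Cov t α p p) (p : V t α) :
    MaxIn t α I.1 p ↔ p ∈ I.1 ∧ ∀ q, Cov t α p q → q ∉ I.1 := by
  constructor
  · rintro ⟨h1, h2⟩
    refine ⟨h1, fun q hc hq => ?_⟩
    have := h2 q hq (Relation.ReflTransGen.single hc)
    subst this
    exact hirr _ hc
  · rintro ⟨h1, h2⟩
    refine ⟨h1, fun q hq hle => ?_⟩
    rcases Relation.ReflTransGen.cases_head hle with h | ⟨r, hr, hrq⟩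
    · exact h.symm
    · exact absurd (I.2.2 _ _ hrq hq) (h2 r hr)

lemma minOut_iff {t : ℕ} {α : ℕ → ℕ} (I : J t α) (hirr : ∀ p, ¬ Cov t α p p) (p : V t α) :
    MinOut t α I.1 p ↔ Elem t α p ∧ p ∉ I.1 ∧ ∀ q, Cov t α q p → q ∈ I.1 := by
  constructor
  · rintro ⟨h0, h1, h2⟩
    refine ⟨h0, h1, fun q hc => ?_⟩
    by_contra hq
    have := h2 q (cov_elem hc).1 hq (Relation.ReflTransGen.single hc)
    subst this
    exact hirr _ hc
  · rintro ⟨h0, h1, h2⟩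
    refine ⟨h0, h1, fun q hqe hq hle => ?_⟩
    rcases Relation.ReflTransGen.cases_tail hle with h | ⟨r, hrq, hr⟩
    · exact h.symm
    · exact absurd (I.2.2 _ _ hrq (h2 r hr)) hq

/-- membership of index `j` in `I`. -/
def PP {t : ℕ} {α : ℕ → ℕ} (I : J t α) (j : ℕ) : Prop := ∃ h : j < nn t α + 1, (⟨j, h⟩ : V t α) ∈ I.1

lemma PP_fin {t : ℕ} {α : ℕ → ℕ} (I : J t α) (p : V t α) : PP I p ↔ p ∈ I.1 :=
  ⟨fun ⟨_, h⟩ => h, fun h => ⟨p.2, h⟩⟩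

lemma PP_zero {t : ℕ} {α : ℕ → ℕ} (I : J t α) : ¬ PP I 0 := by
  rintro ⟨h, h'⟩
  have := I.2.1 _ h'
  simp [Elem] at this

lemma PP_lt {t : ℕ} {α : ℕ → ℕ} {I : J t α} {j : ℕ} (h : PP I j) : j < nn t α + 1 := h.1

lemma cov_irr (a t : ℕ) (ha : 2 ≤ a) (ht : 3 ≤ t) (p : V t (fun _ => a)) :
    ¬ Cov t (fun _ => a) p p := by
  rw [cov_iff a t ha ht]; omega

lemma PP_up {a t : ℕ} (ha : 2 ≤ a) (ht : 3 ≤ t) (I : J t (fun _ => a)) (j : ℕ) (hj : 1 ≤ j)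
    (he : (j / a) % 2 = 0) (h : PP I (j + 1)) : PP I j := by
  obtain ⟨h1, h2⟩ := h
  refine ⟨by omega, I.2.2 _ _ (Relation.ReflTransGen.single ?_) h2⟩
  rw [cov_iff a t ha ht]
  exact ⟨hj, Nat.succ_pos _, Or.inl ⟨rfl, he⟩⟩

lemma odd_lt {a t : ℕ} (ha : 2 ≤ a) (ht : 3 ≤ t) (hodd : t % 2 = 1) (j : ℕ)
    (hj : j < nn t (fun _ => a) + 1)
    (he : (j / a) % 2 = 1) : j + 1 < nn t (fun _ => a) + 1 := by
  rw [nn_const a t ha ht] at *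
  have h1 : j / a < t := by rw [Nat.div_lt_iff_lt_mul (by omega)]; exact hj
  have h2 : j / a + 1 < t := by omega
  have := Nat.div_add_mod j a
  have := Nat.mod_lt j (show a > 0 by omega)
  nlinarith

lemma PP_down {a t : ℕ} (ha : 2 ≤ a) (ht : 3 ≤ t) (hodd : t % 2 = 1)
    (I : J t (fun _ => a)) (j : ℕ) (hj : 1 ≤ j)
    (he : (j / a) % 2 = 1) (h : PP I j) : PP I (j + 1) := by
  obtain ⟨h1, h2⟩ := h
  refine ⟨odd_lt ha ht hodd j h1 he, I.2.2 _ _ (Relation.ReflTransGen.single ?_) h2⟩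
  rw [cov_iff a t ha ht]
  exact ⟨Nat.succ_pos _, hj, Or.inr ⟨rfl, he⟩⟩

lemma maxIn_PP {a t : ℕ} (ha : 2 ≤ a) (ht : 3 ≤ t)
    (I : J t (fun _ => a)) (j : ℕ) (hj : j + 1 < nn t (fun _ => a) + 1) :
    MaxIn t (fun _ => a) I.1 ⟨j + 1, hj⟩ ↔ PP I (j + 1) ∧
      (((j + 1) / a) % 2 = 0 → ¬ PP I (j + 2)) ∧ ((j / a) % 2 = 1 → ¬ PP I j) := by
  rw [maxIn_iff I (cov_irr a t ha ht)]
  simp only [cov_iff a t ha ht]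
  constructor
  · rintro ⟨h1, h2⟩
    refine ⟨⟨hj, h1⟩, fun he ⟨h, hm⟩ => h2 _ ⟨by omega, ?_, Or.inl ⟨rfl, he⟩⟩ hm,
      fun he hP => h2 ⟨j, by omega⟩ ⟨by omega, ?_, Or.inr ⟨rfl, he⟩⟩ hP.2⟩
    · simp
    · rcases Nat.eq_zero_or_pos j with h | h
      · subst h; exact absurd hP (PP_zero I)
      · exact h
  · rintro ⟨h1, h2, h3⟩
    refine ⟨h1.2, ?_⟩
    rintro ⟨q, hq'⟩ ⟨-, hq, ⟨h, he⟩ | ⟨h, he⟩⟩ hm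
    · simp only at h
      subst h
      exact h2 he ⟨_, hm⟩
    · simp only at h he
      obtain rfl : q = j := by omega
      exact h3 he ⟨_, hm⟩

lemma minOut_PP {a t : ℕ} (ha : 2 ≤ a) (ht : 3 ≤ t) (hodd : t % 2 = 1)
    (I : J t (fun _ => a)) (j : ℕ) (hj : j + 1 < nn t (fun _ => a) + 1) :
    MinOut t (fun _ => a) I.1 ⟨j + 1, hj⟩ ↔ ¬ PP I (j + 1) ∧
      (((j + 1) / a) % 2 = 1 → PP I (j + 2)) ∧ ((j / a) % 2 = 0 → 1 ≤ j → PP I j) := by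
  rw [minOut_iff I (cov_irr a t ha ht)]
  simp only [cov_iff a t ha ht]
  constructor
  · rintro ⟨-, h1, h2⟩
    refine ⟨fun h => h1 h.2, fun he => ⟨odd_lt ha ht hodd _ hj he, h2 _ ⟨?_, ?_, Or.inr ⟨rfl, he⟩⟩⟩,
      fun he hP => ⟨by omega, h2 _ ⟨hP, ?_, Or.inl ⟨rfl, he⟩⟩⟩⟩
    · simp
    · simp
    · simp
  · rintro ⟨h1, h2, h3⟩
    refine ⟨by simp [Elem], fun h => h1 ⟨hj, h⟩, ?_⟩
    rintro ⟨q, hq'⟩ ⟨hq, -, ⟨h, he⟩ | ⟨h, he⟩⟩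
    · simp only at h he hq
      obtain rfl : q = j := by omega
      exact (h3 he hq).2
    · simp only at h he hq
      subst h
      exact (h2 he).2

/-- indicator with sentinel `1` at index `0`. -/
noncomputable def E {t : ℕ} {α : ℕ → ℕ} (I : J t α) (j : ℕ) : ℝ :=
  if j = 0 then 1 else if PP I j then 1 else 0

/-- toggleability as a function of the index. -/
noncomputable def T {t : ℕ} {α : ℕ → ℕ} (I : J t α) (j : ℕ) : ℝ :=
  if h : j < nn t α + 1 then Tg t α ⟨j, h⟩ I else 0

lemma T_zero {t : ℕ} {α : ℕ → ℕ} (I : J t α) : T I 0 = 0 := by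
  have h1 : ¬ MinOut t α I.1 ⟨0, Nat.succ_pos _⟩ := by
    rintro ⟨h, -⟩
    simp [Elem] at h
  have h2 : ¬ MaxIn t α I.1 ⟨0, Nat.succ_pos _⟩ := by
    rintro ⟨h, -⟩
    exact PP_zero I ⟨_, h⟩
  unfold T Tg
  rw [dif_pos (Nat.succ_pos _), if_neg h1, if_neg h2]

lemma T_interior {a t : ℕ} (ha : 2 ≤ a) (ht : 3 ≤ t) (hodd : t % 2 = 1)
    (I : J t (fun _ => a)) (j : ℕ) (hj : j + 1 < nn t (fun _ => a) + 1)
    (hd : (j + 1) / a = j / a) :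
    T I (j + 1) = E I j - 2 * E I (j + 1) + E I (j + 2) := by
  unfold T Tg
  rw [dif_pos hj]
  simp only [maxIn_PP ha ht, minOut_PP ha ht hodd, hd]
  have u1 := PP_up ha ht I j
  have u2 := PP_up ha ht I (j + 1) (by omega)
  have d1 := PP_down ha ht hodd I j
  have d2 := PP_down ha ht hodd I (j + 1) (by omega)
  rw [hd] at u2 d2
  have hz := PP_zero I
  unfold E
  rcases Nat.mod_two_eq_zero_or_one (j / a) with h | h
  · rcases Nat.eq_zero_or_pos j with h0 | h0
    · subst h0
      by_cases p1 : PP I 1 <;> by_cases p2 : PP I 2 <;> simp_all <;> norm_num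
    · have h0' : j ≠ 0 := by omega
      by_cases p0 : PP I j <;> by_cases p1 : PP I (j + 1) <;> by_cases p2 : PP I (j + 2) <;>
        simp_all <;> norm_num
  · have h0 : j ≠ 0 := by
      rintro rfl
      simp at h
    have h0' : 1 ≤ j := by omega
    by_cases p0 : PP I j <;> by_cases p1 : PP I (j + 1) <;> by_cases p2 : PP I (j + 2) <;>
        simp_all <;> norm_num

lemma chi_peak {a t : ℕ} (ha : 2 ≤ a) (ht : 3 ≤ t)
    (I : J t (fun _ => a)) (j : ℕ) (hj : j + 1 < nn t (fun _ => a) + 1)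
    (h0 : (j / a) % 2 = 0) (h1 : ((j + 1) / a) % 2 = 1) :
    chi t (fun _ => a) ⟨j + 1, hj⟩ I = E I (j + 1) := by
  unfold chi E
  simp [maxIn_PP ha ht, h0, h1]

lemma chi_valley {a t : ℕ} (ha : 2 ≤ a) (ht : 3 ≤ t) (hodd : t % 2 = 1)
    (I : J t (fun _ => a)) (j : ℕ) (hj : j + 1 < nn t (fun _ => a) + 1)
    (h0 : (j / a) % 2 = 1) (h1 : ((j + 1) / a) % 2 = 0) :
    T I (j + 1) = 1 - E I (j + 1) - chi t (fun _ => a) ⟨j + 1, hj⟩ I := by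
  unfold T Tg chi E
  rw [dif_pos hj]
  simp only [maxIn_PP ha ht, minOut_PP ha ht hodd, h0, h1]
  by_cases p1 : PP I (j + 1)
  · by_cases p2 : PP I (j + 2) ∨ PP I j
    · rcases p2 with p2 | p2 <;> simp [p1, p2]
    · push Not at p2
      simp [p1, p2]
  · simp [p1]

/-- the coefficients. -/
noncomputable def cc (a j : ℕ) : ℝ :=
  if j % a = 0 then (if (j / a) % 2 = 0 then -(a : ℝ) else 0)
  else -((j % a : ℕ) * ((a : ℝ) - (j % a : ℕ)) / 2)

lemma parts (x : ℝ) (e : ℕ → ℝ) (b : ℕ) :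
    ∑ r ∈ Finset.range b, (e (r + 1) + (r + 1 : ℝ) * (x - (r + 1)) / 2 *
      (e r - 2 * e (r + 1) + e (r + 2))) =
    (x - 1) / 2 * e 0 + b * (x - b) / 2 * e (b + 1) - (b + 1) * (x - b - 1) / 2 * e b := by
  induction b with
  | zero => simp
  | succ b ih =>
    rw [Finset.sum_range_succ, ih]
    push_cast
    ring

lemma segment {a t : ℕ} (ha : 2 ≤ a) (ht : 3 ≤ t) (hodd : t % 2 = 1)
    (I : J t (fun _ => a)) (k : ℕ) (hk : k < t) :
    ∑ r ∈ Finset.range a, (E I (k * a + r) - cc a (k * a + r) * T I (k * a + r)) =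
      E I (k * a) - cc a (k * a) * T I (k * a) + (a - 1) / 2 * (E I (k * a) + E I ((k + 1) * a)) := by
  obtain ⟨b, rfl⟩ : ∃ b, a = b + 1 := ⟨a - 1, by omega⟩
  have hn := nn_const _ t ha ht
  rw [Finset.sum_range_succ']
  have := parts ((b + 1 : ℕ) : ℝ) (fun r => E I (k * (b + 1) + r)) b
  have h2 : ∑ r ∈ Finset.range b, (E I (k * (b + 1) + (r + 1)) -
      cc (b + 1) (k * (b + 1) + (r + 1)) * T I (k * (b + 1) + (r + 1))) =
      ∑ r ∈ Finset.range b, (E I (k * (b + 1) + (r + 1)) + (r + 1 : ℝ) * (((b + 1 : ℕ) : ℝ) - (r + 1)) / 2 *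
      (E I (k * (b + 1) + r) - 2 * E I (k * (b + 1) + (r + 1)) + E I (k * (b + 1) + (r + 2)))) := by
    apply Finset.sum_congr rfl
    intro r hr
    rw [Finset.mem_range] at hr
    have hmod : (k * (b + 1) + (r + 1)) % (b + 1) = r + 1 := by
      rw [mul_comm, Nat.mul_add_mod]
      exact Nat.mod_eq_of_lt (by omega)
    have hd : ∀ s, s < b + 1 → (k * (b + 1) + s) / (b + 1) = k := by
      intro s hs
      apply Nat.div_eq_of_lt_le
      · linarith
      · nlinarith
    have hT := T_interior ha ht hodd I (k * (b + 1) + r) (by rw [hn]; nlinarith)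
      (by rw [add_assoc, hd _ (by omega), hd _ (by omega)])
    simp only [add_assoc] at hT
    rw [hT, cc, hmod, if_neg (by omega)]
    push_cast
    ring
  rw [h2, this]
  simp only [add_zero]
  rw [show k * (b + 1) + (b + 1) = (k + 1) * (b + 1) by ring]
  push_cast
  ring

lemma sum_blocks (a : ℕ) (f : ℕ → ℝ) (t : ℕ) :
    ∑ j ∈ Finset.range (t * a), f j = ∑ k ∈ Finset.range t, ∑ r ∈ Finset.range a, f (k * a + r) := by
  induction t with
  | zero => simp
  | succ t ih =>
    rw [add_mul, one_mul, Finset.sum_range_add, ih, Finset.sum_range_succ]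

lemma shared {a t : ℕ} (ha : 2 ≤ a) (ht : 3 ≤ t) (hodd : t % 2 = 1)
    (I : J t (fun _ => a)) (k : ℕ) (hk : k < t) :
    a * E I (k * a) - cc a (k * a) * T I (k * a) =
      a * ((if k % 2 = 1 then chi t (fun _ => a) (sElx t (fun _ => a) k) I else 0) -
        (if k % 2 = 0 ∧ 1 ≤ k then chi t (fun _ => a) (sElx t (fun _ => a) k) I else 0))
      + a * (if k % 2 = 0 then 1 else 0) := by
  have hn := nn_const _ t ha ht
  rcases Nat.eq_zero_or_pos k with h | h
  · subst h
    simp [T_zero, E]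
  · obtain ⟨l, rfl⟩ : ∃ l, k = l + 1 := ⟨k - 1, by omega⟩
    have hlt : (l + 1) * a < nn t (fun _ => a) + 1 := by rw [hn]; nlinarith
    have hs : sElx t (fun _ => a) (l + 1) = ⟨(l + 1) * a, hlt⟩ := by
      unfold sElx xel
      ext
      simp only [m_const]
      exact Nat.mod_eq_of_lt hlt
    have hd1 : ((l + 1) * a) / a = l + 1 := Nat.mul_div_cancel _ (by omega)
    have hm : ((l + 1) * a) % a = 0 := Nat.mul_mod_left _ _
    rw [hs, cc, hm, hd1]
    obtain ⟨j, hj⟩ : ∃ j, (l + 1) * a = j + 1 := ⟨(l + 1) * a - 1, by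
      have : 0 < (l + 1) * a := by positivity
      omega⟩
    have hd0 : j / a = l := by
      apply Nat.div_eq_of_lt_le
      · nlinarith
      · rw [hj]; omega
    simp only [hj] at hlt hd1 ⊢
    rcases Nat.mod_two_eq_zero_or_one (l + 1) with h | h
    · rw [chi_valley ha ht hodd I j hlt (by rw [hd0]; omega) (by rw [hd1]; exact h)]
      simp [h]
      ring
    · rw [chi_peak ha ht I j hlt (by rw [hd0]; omega) (by rw [hd1]; exact h)]
      simp [h]

lemma count_even (s : ℕ) :
    ∑ k ∈ Finset.range (2 * s + 1), (if k % 2 = 0 then (1 : ℝ) else 0) = s + 1 := by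
  induction s with
  | zero =>
    rw [Finset.sum_range_succ, if_pos (by omega)]
    simp
  | succ s ih =>
    rw [show 2 * (s + 1) + 1 = 2 * s + 1 + 1 + 1 by ring, Finset.sum_range_succ,
      Finset.sum_range_succ, ih, if_neg (by omega), if_pos (by omega)]
    push_cast; ring

lemma total {a t : ℕ} (ha : 2 ≤ a) (ht : 3 ≤ t) (hodd : t % 2 = 1) (I : J t (fun _ => a)) :
    ∑ j ∈ Finset.range (t * a), (E I j - cc a j * T I j) = 1 + (t * a - 1 : ℝ) / 2 + a *
      ((∑ i ∈ (Finset.range t).filter (fun i => i % 2 = 1),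
              chi t (fun _ => a) (sElx t (fun _ => a) i) I)
           - ∑ i ∈ (Finset.range t).filter (fun i => i % 2 = 0 ∧ 1 ≤ i),
              chi t (fun _ => a) (sElx t (fun _ => a) i) I) := by
  have hn := nn_const _ t ha ht
  have htel : ∑ k ∈ Finset.range t, (E I ((k + 1) * a) - E I (k * a)) = -1 := by
    rw [Finset.sum_range_sub (fun k => E I (k * a))]
    have h1 : E I (t * a) = 0 := by
      unfold E
      rw [if_neg (by positivity), if_neg]
      intro h
      have := PP_lt h
      omega
    rw [h1]
    simp [E]
  have h : ∀ k ∈ Finset.range t,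
      ∑ r ∈ Finset.range a, (E I (k * a + r) - cc a (k * a + r) * T I (k * a + r)) =
      (a : ℝ) * ((if k % 2 = 1 then chi t (fun _ => a) (sElx t (fun _ => a) k) I else 0) -
        (if k % 2 = 0 ∧ 1 ≤ k then chi t (fun _ => a) (sElx t (fun _ => a) k) I else 0))
      + a * (if k % 2 = 0 then 1 else 0) + ((a : ℝ) - 1) / 2 * (E I ((k + 1) * a) - E I (k * a)) := by
    intro k hk
    rw [Finset.mem_range] at hk
    rw [segment ha ht hodd I k hk, ← shared ha ht hodd I k hk]
    ring
  rw [sum_blocks, Finset.sum_congr rfl h, Finset.sum_add_distrib, Finset.sum_add_distrib,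
    ← Finset.mul_sum, ← Finset.mul_sum, ← Finset.mul_sum, htel, Finset.sum_sub_distrib,
    Finset.sum_filter, Finset.sum_filter]
  obtain ⟨s, rfl⟩ : ∃ s, t = 2 * s + 1 := ⟨t / 2, by omega⟩
  rw [count_even]
  push_cast
  ring

/-- Theorem `oic as peaks and valleys`.
For `F = F̆(a^t)` with `t` odd (`n = ta − 1`):
`χ̂ ≡ n/2 + a·(Σ_{peaks p} χ_p − Σ_{valleys v} χ_v)`.
The peaks are the shared elements `s_i` with `i` odd, the valleys those with `i` even. -/
theorem statement9 (a t : ℕ) (ha : 2 ≤ a) (ht : 3 ≤ t) (hodd : t % 2 = 1) :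
    Equiv' t (fun _ => a)
      (fun I => ∑ p ∈ Finset.univ.filter (fun p : V t (fun _ => a) => Elem t (fun _ => a) p),
        chiHat t (fun _ => a) p I)
      (fun I => (nn t (fun _ => a) : ℝ) / 2
        + (a : ℝ) *
          ((∑ i ∈ (Finset.range t).filter (fun i => i % 2 = 1),
              chi t (fun _ => a) (sElx t (fun _ => a) i) I)
           - ∑ i ∈ (Finset.range t).filter (fun i => i % 2 = 0 ∧ 1 ≤ i),
              chi t (fun _ => a) (sElx t (fun _ => a) i) I)) := by
  have hn := nn_const _ t ha ht
  have hnR : (nn t (fun _ => a) : ℝ) = t * a - 1 := by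
    have : ((nn t (fun _ => a) + 1 : ℕ) : ℝ) = ((t * a : ℕ) : ℝ) := by rw [hn]
    push_cast at this
    linarith
  unfold Equiv'
  have key : ∀ (f g : J t (fun _ => a) → ℝ),
      (∀ I, f I - g I = ∑ p : V t (fun _ => a), cc a p * T I p) →
      f - g ∈ ToggSpan t (fun _ => a) := by
    intro f g h
    have : f - g = ∑ p ∈ Finset.univ.filter (fun p : V t (fun _ => a) => Elem t (fun _ => a) p),
        cc a p • Tg t (fun _ => a) p := by
      funext I
      rw [Pi.sub_apply, h I, Finset.sum_apply, Finset.sum_filter]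
      apply Finset.sum_congr rfl
      intro p _
      by_cases hp : Elem t (fun _ => a) p
      · rw [if_pos hp]
        simp [T, p.2]
      · rw [if_neg hp]
        have : (p : ℕ) = 0 := by
          unfold Elem at hp
          omega
        rw [this, T_zero, mul_zero]
    rw [this]
    refine Submodule.sum_mem _ fun p hp => Submodule.smul_mem _ _ (Submodule.subset_span ?_)
    exact ⟨p, (Finset.mem_filter.mp hp).2, rfl⟩
  apply key
  intro I
  have h1 : ∑ p ∈ Finset.univ.filter (fun p : V t (fun _ => a) => Elem t (fun _ => a) p),
      chiHat t (fun _ => a) p I = ∑ j ∈ Finset.range (t * a), E I j - 1 := by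
    have e1 : ∑ j ∈ Finset.range (t * a), E I j
        = ∑ j ∈ Finset.range (t * a), ((if j = 0 then (1 : ℝ) else 0) + if PP I j then 1 else 0) := by
      apply Finset.sum_congr rfl
      intro j _
      unfold E
      by_cases hj : j = 0
      · subst hj
        simp [PP_zero]
      · simp [hj]
    have hpos : 0 < t * a := by positivity
    rw [e1, Finset.sum_add_distrib, Finset.sum_ite_eq', if_pos (Finset.mem_range.mpr hpos), ← hn,
      ← Fin.sum_univ_eq_sum_range (fun j => if PP I j then (1 : ℝ) else 0), Finset.sum_filter,
      add_sub_cancel_left]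
    apply Finset.sum_congr rfl
    intro p _
    unfold chiHat
    simp only [PP_fin]
    by_cases hp : p ∈ I.1
    · simp [hp, I.2.1 p hp]
    · simp [hp]
  have h2 := total ha ht hodd I
  rw [Finset.sum_sub_distrib] at h2
  rw [h1, hnR]
  have h4 : ∑ p : V t (fun _ => a), cc a p * T I p = ∑ j ∈ Finset.range (t * a), cc a j * T I j := by
    rw [← hn]
    exact Fin.sum_univ_eq_sum_range (fun j => cc a j * T I j) (nn t (fun _ => a) + 1)
  rw [h4]
  linarith

end Fence
end

section
/- Let α = (α_1,…,α_t) be palindromic (α_i = α_{t+1−i} for all i) with t odd, let F = F̆(α) with elements x_1,…,x_n where n = #F, and suppose that for every i ∈ {1,…,t−1} the statistic χ̂_{s_i} + χ̂_{s_{t−i}} is 1-mesic under rowmotion on J(F). Then: (1) for every k ∈ {1,…,n}, the statistic χ̂_{x_k} + χ̂_{x_{n−k+1}} is 1-mesic under rowmotion; and (2) for every k ∈ {1,…,n}, the statistic χ_{x_k} − χ_{x_{n−k+1}} is 0-mesic under rowmotion. -/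
open scoped Classical

namespace Fence

/-- edge `k — k+1` goes up. -/
def up (t : ℕ) (α : ℕ → ℕ) (k : ℕ) : Prop :=
  ∃ i < t, i % 2 = 0 ∧ m α i ≤ k ∧ k < m α (i + 1)

theorem m_succ (α : ℕ → ℕ) (i : ℕ) : m α (i + 1) = m α i + α i := by
  simp [m, Finset.sum_range_succ]

theorem m_mono (α : ℕ → ℕ) {i j : ℕ} (h : i ≤ j) : m α i ≤ m α j :=
  Finset.sum_le_sum_of_subset (by simpa using h)

theorem seg_unique {α : ℕ → ℕ} {i j k : ℕ} (h1 : m α i ≤ k) (h2 : k < m α (i + 1))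
    (h3 : m α j ≤ k) (h4 : k < m α (j + 1)) : i = j := by
  rcases lt_trichotomy i j with h | h | h
  · have := m_mono α (show i + 1 ≤ j from h); omega
  · exact h
  · have := m_mono α (show j + 1 ≤ i from h); omega

theorem seg_exists (α : ℕ → ℕ) (t k : ℕ) (h : k < m α t) :
    ∃ i < t, m α i ≤ k ∧ k < m α (i + 1) := by
  induction t with
  | zero => simp [m] at h
  | succ t ih =>
    by_cases hk : k < m α t
    · obtain ⟨i, hi, h'⟩ := ih hk
      exact ⟨i, by omega, h'⟩
    · exact ⟨t, by omega, by omega, h⟩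

theorem up_iff {t : ℕ} {α : ℕ → ℕ} {i k : ℕ} (hi : i < t) (h1 : m α i ≤ k)
    (h2 : k < m α (i + 1)) : up t α k ↔ i % 2 = 0 := by
  constructor
  · rintro ⟨j, hj, hj2, h3, h4⟩
    rw [seg_unique h1 h2 h3 h4]; exact hj2
  · intro h; exact ⟨i, hi, h, h1, h2⟩

theorem mt_eq {t : ℕ} {α : ℕ → ℕ} (hF : IsFence t α) : m α t = nn t α + 1 := by
  obtain ⟨h1, h2, h3, h4⟩ := hF
  have := m_mono α (show 1 ≤ t by omega)
  have h5 : m α 1 = α 0 := by simp [m]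
  unfold nn; omega

theorem cov_iff_s12 {t : ℕ} {α : ℕ → ℕ} (hF : IsFence t α) (a b : V t α) :
    Cov t α a b ↔ (1 ≤ (a : ℕ) ∧ (b : ℕ) = a + 1 ∧ up t α a) ∨
      (1 ≤ (b : ℕ) ∧ (a : ℕ) = b + 1 ∧ ¬ up t α b) := by
  have hm := mt_eq hF
  have ha := a.2
  have hb := b.2
  constructor
  · rintro ⟨i, hi, hd, h1, h2, h3, h4⟩
    rcases hd with ⟨hd, he⟩ | ⟨hd, he⟩
    · left
      have hmin : min (a : ℕ) (b : ℕ) = a := by omega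
      rw [hmin] at h1 h2 h3
      exact ⟨h3, he, (up_iff hi h1 h2).2 hd⟩
    · right
      have hmin : min (a : ℕ) (b : ℕ) = b := by omega
      rw [hmin] at h1 h2 h3
      refine ⟨h3, he, fun h => ?_⟩
      have := (up_iff hi h1 h2).1 h
      omega
  · rintro (⟨h1, h2, h3⟩ | ⟨h1, h2, h3⟩)
    · obtain ⟨i, hi, hi2, h4, h5⟩ := h3
      exact ⟨i, hi, Or.inl ⟨hi2, h2⟩, by omega, by omega, by omega, by omega⟩
    · obtain ⟨i, hi, h4, h5⟩ := seg_exists α t b (by omega)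
      rw [up_iff hi h4 h5] at h3
      exact ⟨i, hi, Or.inr ⟨by omega, h2⟩, by omega, by omega, by omega, by omega⟩

/-- a rank function. -/
noncomputable def rk (t : ℕ) (α : ℕ → ℕ) (k : ℕ) : ℤ :=
  ∑ j ∈ Finset.range k, if up t α j then 1 else -1

theorem cov_rk {t : ℕ} {α : ℕ → ℕ} (hF : IsFence t α) {a b : V t α} (h : Cov t α a b) :
    rk t α a < rk t α b := by
  rcases (cov_iff_s12 hF a b).1 h with ⟨_, h2, h3⟩ | ⟨_, h2, h3⟩
  · simp [rk, h2, Finset.sum_range_succ, h3]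
  · simp [rk, h2, Finset.sum_range_succ, h3]

theorem le_rk {t : ℕ} {α : ℕ → ℕ} (hF : IsFence t α) {a b : V t α} (h : Le t α a b) :
    a = b ∨ rk t α a < rk t α b := by
  induction h with
  | refl => left; rfl
  | tail _ hc ih =>
    right
    have := cov_rk hF hc
    rcases ih with rfl | ih
    · exact this
    · exact ih.trans this

theorem le_antisymm' {t : ℕ} {α : ℕ → ℕ} (hF : IsFence t α) {a b : V t α} (h : Le t α a b)
    (h' : Le t α b a) : a = b := by
  rcases le_rk hF h with h1 | h1
  · exact h1
  · rcases le_rk hF h' with h2 | h2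
    · exact h2.symm
    · omega

theorem maxIn_rho {t : ℕ} {α : ℕ → ℕ} (hF : IsFence t α) (I : J t α) (p : V t α) :
    MaxIn t α (rho t α I).1 p ↔ MinOut t α I.1 p := by
  constructor
  · rintro ⟨⟨p', hp', hle⟩, h⟩
    have := h p' ⟨p', hp', Relation.ReflTransGen.refl⟩ hle
    rwa [← this]
  · intro hp
    refine ⟨⟨p, hp, Relation.ReflTransGen.refl⟩, ?_⟩
    rintro q ⟨p', hp', hle⟩ hpq
    have h1 : p = p' := hp'.2.2 p hp.1 hp.2.1 (Relation.ReflTransGen.trans hpq hle)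
    subst h1
    exact le_antisymm' hF hle hpq

theorem exists_minOut {t : ℕ} {α : ℕ → ℕ} (hF : IsFence t α) (I : J t α) (q : V t α)
    (hq : Elem t α q) (hqI : q ∉ I.1) : ∃ p, MinOut t α I.1 p ∧ Le t α p q := by
  obtain ⟨p, hp, hmin⟩ := Set.exists_min_image
    {p : V t α | Elem t α p ∧ p ∉ I.1 ∧ Le t α p q} (fun p => rk t α p) (Set.toFinite _)
    ⟨q, hq, hqI, Relation.ReflTransGen.refl⟩
  refine ⟨p, ⟨hp.1, hp.2.1, fun r hr hrI hle => ?_⟩, hp.2.2⟩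
  rcases le_rk hF hle with h | h
  · exact h
  · have := hmin r ⟨hr, hrI, Relation.ReflTransGen.trans hle hp.2.2⟩
    omega

theorem rho_inj {t : ℕ} {α : ℕ → ℕ} (hF : IsFence t α) : Function.Injective (rho t α) := by
  have key : ∀ I K : J t α, rho t α I = rho t α K → I.1 ⊆ K.1 := by
    intro I K h q hq
    by_contra hqK
    obtain ⟨p, hp, hle⟩ := exists_minOut hF K q (I.2.1 q hq) hqK
    rw [← maxIn_rho hF, ← h, maxIn_rho hF] at hp
    exact hp.2.1 (I.2.2 p q hle hq)
  intro I K h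
  exact Subtype.ext (Set.Subset.antisymm (key I K h) (key K I h.symm))

theorem orbit_sum {X : Type*} [Finite X] {ρ : X → X} (hρ : Function.Injective ρ) (x : X)
    (f : X → ℝ) : ∑ᶠ y ∈ orbit ρ x, f (ρ y) = ∑ᶠ y ∈ orbit ρ x, f y := by
  have himg : ρ '' orbit ρ x = orbit ρ x := by
    apply Set.eq_of_subset_of_ncard_le
    · rintro _ ⟨_, ⟨k, rfl⟩, rfl⟩
      exact ⟨k + 1, by rw [Function.iterate_succ_apply']⟩
    · rw [Set.ncard_image_of_injective _ hρ]
    · exact Set.toFinite _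
  conv_rhs => rw [← himg]
  rw [finsum_mem_image hρ.injOn]

/-- membership with sentinels. -/
def H (t : ℕ) (α : ℕ → ℕ) (I : J t α) (k : ℕ) : Prop :=
  k = 0 ∨ (k ≤ nn t α ∧ xel t α k ∈ I.1)

noncomputable def hh (t : ℕ) (α : ℕ → ℕ) (k : ℕ) (I : J t α) : ℝ := if H t α I k then 1 else 0

theorem xel_val {t : ℕ} {α : ℕ → ℕ} {k : ℕ} (h : k ≤ nn t α) : (xel t α k : ℕ) = k := by
  simp only [xel]; exact Nat.mod_eq_of_lt (by omega)

theorem xel_self {t : ℕ} {α : ℕ → ℕ} (q : V t α) : xel t α (q : ℕ) = q :=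
  Fin.ext (xel_val (by have := q.2; omega))

theorem hh_eq {t : ℕ} {α : ℕ → ℕ} {k : ℕ} (h1 : 1 ≤ k) (h2 : k ≤ nn t α) :
    hh t α k = chiHat t α (xel t α k) := by
  funext I
  simp [hh, chiHat, H, h2, show k ≠ 0 by omega]

theorem H_elem {t : ℕ} {α : ℕ → ℕ} (I : J t α) {q : V t α} (h : 1 ≤ (q : ℕ)) :
    H t α I q ↔ q ∈ I.1 := by
  have := q.2
  simp [H, xel_self, show (q : ℕ) ≠ 0 by omega, show (q : ℕ) ≤ nn t α by omega]

theorem H_up {t : ℕ} {α : ℕ → ℕ} (hF : IsFence t α) (I : J t α) {k : ℕ} (hu : up t α k)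
    (h : H t α I (k + 1)) : H t α I k := by
  rcases Nat.eq_zero_or_pos k with rfl | hk
  · left; rfl
  · rcases h with h | ⟨h1, h2⟩
    · omega
    · refine Or.inr ⟨by omega, I.2.2 _ _ (Relation.ReflTransGen.single ?_) h2⟩
      rw [cov_iff_s12 hF, xel_val h1, xel_val (show k ≤ nn t α by omega)]
      left; exact ⟨hk, rfl, hu⟩

theorem up_zero {t : ℕ} {α : ℕ → ℕ} (hF : IsFence t α) : up t α 0 := by
  obtain ⟨h1, h2, h3, h4⟩ := hF
  exact ⟨0, by omega, rfl, by simp [m], by rw [m_succ]; omega⟩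

theorem up_last {t : ℕ} {α : ℕ → ℕ} (hF : IsFence t α) (hodd : t % 2 = 1) :
    up t α (nn t α) := by
  have hm := mt_eq hF
  obtain ⟨h1, h2, h3, h4⟩ := hF
  have h5 := m_succ α (t - 1)
  rw [show t - 1 + 1 = t by omega] at h5
  exact ⟨t - 1, by omega, by omega, by omega, by rw [show t - 1 + 1 = t by omega]; omega⟩

theorem H_down {t : ℕ} {α : ℕ → ℕ} (hF : IsFence t α) (hodd : t % 2 = 1) (I : J t α) {k : ℕ}
    (hu : ¬ up t α k) (h : H t α I k) : H t α I (k + 1) := by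
  rcases h with rfl | ⟨h1, h2⟩
  · exact absurd (up_zero hF) hu
  · have hk : k ≠ nn t α := by rintro rfl; exact hu (up_last hF hodd)
    have hk0 : k ≠ 0 := by rintro rfl; exact hu (up_zero hF)
    refine Or.inr ⟨by omega, I.2.2 _ _ (Relation.ReflTransGen.single ?_) h2⟩
    rw [cov_iff_s12 hF, xel_val h1, xel_val (show k + 1 ≤ nn t α by omega)]
    right; exact ⟨by omega, rfl, hu⟩

theorem maxIn_cov {t : ℕ} {α : ℕ → ℕ} (hF : IsFence t α) (I : J t α) (p : V t α) :
    MaxIn t α I.1 p ↔ p ∈ I.1 ∧ ∀ q, Cov t α p q → q ∉ I.1 := by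
  constructor
  · rintro ⟨h1, h2⟩
    refine ⟨h1, fun q hc hq => ?_⟩
    have := h2 q hq (Relation.ReflTransGen.single hc)
    have h3 := cov_rk hF hc
    rw [this] at h3
    omega
  · rintro ⟨h1, h2⟩
    refine ⟨h1, fun q hq hle => ?_⟩
    rcases Relation.ReflTransGen.cases_head hle with h | ⟨c, hc, hcq⟩
    · exact h.symm
    · exact absurd (I.2.2 _ _ hcq hq) (h2 c hc)

theorem minOut_cov {t : ℕ} {α : ℕ → ℕ} (hF : IsFence t α) (I : J t α) (p : V t α) :
    MinOut t α I.1 p ↔ Elem t α p ∧ p ∉ I.1 ∧ ∀ q, Cov t α q p → q ∈ I.1 := by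
  constructor
  · rintro ⟨h0, h1, h2⟩
    refine ⟨h0, h1, fun q hc => ?_⟩
    by_contra hq
    have := h2 q (cov_elem hc).1 hq (Relation.ReflTransGen.single hc)
    have h3 := cov_rk hF hc
    rw [this] at h3
    omega
  · rintro ⟨h0, h1, h2⟩
    refine ⟨h0, h1, fun q _ hq hle => ?_⟩
    rcases Relation.ReflTransGen.cases_tail hle with h | ⟨c, hqc, hc⟩
    · exact h.symm
    · exact absurd (I.2.2 _ _ hqc (h2 c hc)) hq

theorem maxIn_iff_s12 {t : ℕ} {α : ℕ → ℕ} (hF : IsFence t α) (I : J t α) {k : ℕ}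
    (h2 : k + 1 ≤ nn t α) :
    MaxIn t α I.1 (xel t α (k + 1)) ↔ H t α I (k + 1) ∧ (up t α (k + 1) → ¬ H t α I (k + 2)) ∧
      (¬ up t α k → ¬ H t α I k) := by
  have hv := xel_val h2
  rw [maxIn_cov hF, ← H_elem I (by omega), hv]
  refine and_congr_right fun _ => ?_
  constructor
  · intro h
    constructor
    · rintro hu (h0 | ⟨hn, hm⟩)
      · omega
      · refine h _ ?_ hm
        rw [cov_iff_s12 hF, hv, xel_val hn]
        left; exact ⟨by omega, rfl, hu⟩
    · rintro hu (rfl | ⟨hn, hm⟩)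
      · exact hu (up_zero hF)
      · refine h _ ?_ hm
        have : k ≠ 0 := by rintro rfl; exact hu (up_zero hF)
        rw [cov_iff_s12 hF, hv, xel_val hn]
        right; exact ⟨by omega, rfl, hu⟩
  · rintro ⟨ha, hb⟩ q hc hq
    rw [← H_elem I (cov_elem hc).2] at hq
    rw [cov_iff_s12 hF, hv] at hc
    rcases hc with ⟨_, he, hu⟩ | ⟨_, he, hu⟩
    · rw [he] at hq; exact ha hu hq
    · have he : (q : ℕ) = k := by omega
      rw [he] at hq hu; exact hb hu hq

theorem minOut_iff_s12 {t : ℕ} {α : ℕ → ℕ} (hF : IsFence t α) (hodd : t % 2 = 1) (I : J t α)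
    {k : ℕ} (h2 : k + 1 ≤ nn t α) :
    MinOut t α I.1 (xel t α (k + 1)) ↔ ¬ H t α I (k + 1) ∧ (¬ up t α (k + 1) → H t α I (k + 2)) ∧
      (up t α k → H t α I k) := by
  have hv := xel_val h2
  rw [minOut_cov hF, ← H_elem I (by omega), hv, Elem, hv]
  constructor
  · rintro ⟨_, h0, h⟩
    refine ⟨h0, fun hu => ?_, fun hu => ?_⟩
    · have hn : k + 1 ≠ nn t α := by
        intro he; rw [he] at hu; exact hu (up_last hF hodd)
      refine Or.inr ⟨by omega, h _ ?_⟩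
      rw [cov_iff_s12 hF, hv, xel_val (show k + 2 ≤ nn t α by omega)]
      right; exact ⟨by omega, rfl, hu⟩
    · rcases Nat.eq_zero_or_pos k with rfl | hk
      · left; rfl
      · refine Or.inr ⟨by omega, h _ ?_⟩
        rw [cov_iff_s12 hF, hv, xel_val (show k ≤ nn t α by omega)]
        left; exact ⟨by omega, rfl, hu⟩
  · rintro ⟨h0, ha, hb⟩
    refine ⟨by omega, h0, fun q hc => ?_⟩
    rw [← H_elem I (cov_elem hc).1]
    rw [cov_iff_s12 hF, hv] at hc
    rcases hc with ⟨_, he, hu⟩ | ⟨_, he, hu⟩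
    · have he : (q : ℕ) = k := by omega
      rw [he] at hu ⊢; exact hb hu
    · rw [he]; exact ha hu

theorem affine_const (g : ℕ → ℝ) (a l : ℕ) (c : ℝ) (ha : g a = c) (hb : g (a + l) = c)
    (h : ∀ j, j + 1 < l → 2 * g (a + j + 1) = g (a + j) + g (a + j + 2)) (j : ℕ) (hj : j ≤ l) :
    g (a + j) = c := by
  have key : ∀ j, (j ≤ l → g (a + j) = c + j * (g (a + 1) - c)) ∧
      (j + 1 ≤ l → g (a + j + 1) = c + (j + 1) * (g (a + 1) - c)) := by
    intro j
    induction j with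
    | zero => simp [ha]
    | succ j ih =>
      refine ⟨fun hj => ?_, fun hj => ?_⟩
      · have := ih.2 hj
        push_cast; rw [← this]; rfl
      · have h1 := ih.1 (by omega)
        have h2 := ih.2 (by omega)
        have h3 := h j (by omega)
        rw [show a + (j + 1) + 1 = a + j + 2 by ring]
        push_cast; linarith
  rcases Nat.eq_zero_or_pos l with rfl | hl
  · rw [Nat.le_zero.1 hj]; exact ha
  · have h1 := (key l).1 le_rfl
    rw [hb] at h1
    have h2 : (l : ℝ) * (g (a + 1) - c) = 0 := by linarith
    have h3 : g (a + 1) - c = 0 := by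
      rcases mul_eq_zero.1 h2 with h | h
      · exact absurd h (by positivity)
      · exact h
    rw [(key j).1 hj, h3]; ring

theorem m_sym {t : ℕ} {α : ℕ → ℕ}
    (hpal : ∀ i, 1 ≤ i → i ≤ t → α (i - 1) = α (t - i)) (i : ℕ) (hi : i ≤ t) :
    m α i + m α (t - i) = m α t := by
  induction i with
  | zero => simp [m]
  | succ i ih =>
    have h1 := ih (by omega)
    have h2 := m_succ α i
    have h3 := m_succ α (t - (i + 1))
    have h4 := hpal (i + 1) (by omega) hi
    rw [show t - (i + 1) + 1 = t - i by omega] at h3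
    simp only [Nat.add_sub_cancel] at h4
    omega

theorem up_sym {t : ℕ} {α : ℕ → ℕ} (hF : IsFence t α) (hodd : t % 2 = 1)
    (hpal : ∀ i, 1 ≤ i → i ≤ t → α (i - 1) = α (t - i)) {k l : ℕ} (hk : k + l = nn t α) :
    up t α l ↔ up t α k := by
  have hm := mt_eq hF
  obtain ⟨i, hi, h1, h2⟩ := seg_exists α t k (by omega)
  have h3 := m_sym hpal i (by omega)
  have h4 := m_sym hpal (i + 1) (by omega)
  rw [up_iff hi h1 h2, up_iff (i := t - (i + 1)) (by omega) (by omega)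
    (by rw [show t - (i + 1) + 1 = t - i by omega]; omega)]
  omega

/-- Theorem `shared sums are sufficient`.
Let `α` be palindromic with `t` odd, and suppose `χ̂_{s_i} + χ̂_{s_{t−i}}` is 1-mesic under
rowmotion for all `i ∈ [t−1]`. Then for all `k ∈ [n]`:
(1) `χ̂_{x_k} + χ̂_{x_{n−k+1}}` is 1-mesic, and (2) `χ_{x_k} − χ_{x_{n−k+1}}` is 0-mesic. -/
theorem statement12 (t : ℕ) (α : ℕ → ℕ) (hF : IsFence t α) (hodd : t % 2 = 1)
    (hpal : ∀ i, 1 ≤ i → i ≤ t → α (i - 1) = α (t - i))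
    (hmes : ∀ i, 1 ≤ i → i ≤ t - 1 →
      IsMesic (rho t α)
        (fun I => chiHat t α (sElx t α i) I + chiHat t α (sElx t α (t - i)) I) 1) :
    (∀ k, 1 ≤ k → k ≤ nn t α →
      IsMesic (rho t α)
        (fun I => chiHat t α (xel t α k) I + chiHat t α (xel t α (nn t α - k + 1)) I) 1)
    ∧ (∀ k, 1 ≤ k → k ≤ nn t α →
      IsMesic (rho t α)
        (fun I => chi t α (xel t α k) I - chi t α (xel t α (nn t α - k + 1)) I) 0) := by
  have hm := mt_eq hF
  set n := nn t α with hn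
  have main : ∀ x : J t α,
      (∀ k, 1 ≤ k → k ≤ n → ∑ᶠ y ∈ orbit (rho t α) x,
        (chiHat t α (xel t α k) y + chiHat t α (xel t α (n - k + 1)) y)
          = (orbit (rho t α) x).ncard) ∧
      (∀ k, 1 ≤ k → k ≤ n → ∑ᶠ y ∈ orbit (rho t α) x,
        (chi t α (xel t α k) y - chi t α (xel t α (n - k + 1)) y) = 0) := by
    intro x
    have hfin : (orbit (rho t α) x).Finite := Set.toFinite _
    set O := hfin.toFinset with hO
    have hconv : ∀ f : J t α → ℝ, ∑ᶠ y ∈ orbit (rho t α) x, f y = ∑ y ∈ O, f y :=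
      fun f => finsum_mem_eq_finite_toFinset_sum f hfin
    set N : ℝ := ((orbit (rho t α) x).ncard : ℝ) with hN
    have hcard : ∑ y ∈ O, (1 : ℝ) = N := by
      rw [Finset.sum_const, hN, Set.ncard_eq_toFinset_card _ hfin]; simp [hO]
    have hrho : ∀ k, ∑ y ∈ O, chi t α (xel t α k) y
        = ∑ y ∈ O, (if MinOut t α y.1 (xel t α k) then (1 : ℝ) else 0) := by
      intro k
      rw [← hconv, ← orbit_sum (rho_inj hF), hconv]
      refine Finset.sum_congr rfl fun y _ => ?_
      simp only [chi, maxIn_rho hF]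
    set f : ℕ → ℝ := fun k => ∑ y ∈ O, hh t α k y with hf
    have f0 : f 0 = N := by
      rw [← hcard]; exact Finset.sum_congr rfl fun y _ => by simp [hh, H]
    have fn : f (n + 1) = 0 := Finset.sum_eq_zero fun y _ => by simp [hh, H, hn]
    -- the averages of `χ`
    have cU : ∀ k, k + 1 ≤ n → up t α k → up t α (k + 1) →
        ∑ y ∈ O, chi t α (xel t α (k + 1)) y = f (k + 1) - f (k + 2) := by
      intro k hk hu hu'
      rw [hf, ← Finset.sum_sub_distrib]
      refine Finset.sum_congr rfl fun y _ => ?_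
      have := H_up hF y hu'
      simp only [chi, hh, maxIn_iff_s12 hF y hk]
      by_cases h1 : H t α y (k + 1) <;> by_cases h2 : H t α y (k + 2) <;>
        first
        | exact absurd (this h2) h1
        | exact absurd (this h1) h2
        | simp [hu, hu', h1, h2]
    have cU' : ∀ k, k + 1 ≤ n → up t α k → up t α (k + 1) →
        ∑ y ∈ O, chi t α (xel t α (k + 1)) y = f k - f (k + 1) := by
      intro k hk hu hu'
      rw [hrho, hf, ← Finset.sum_sub_distrib]
      refine Finset.sum_congr rfl fun y _ => ?_
      have := H_up hF y hu
      simp only [hh, minOut_iff_s12 hF hodd y hk]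
      by_cases h1 : H t α y (k + 1) <;> by_cases h2 : H t α y k <;>
        first
        | exact absurd (this h2) h1
        | exact absurd (this h1) h2
        | simp [hu, hu', h1, h2]
    have cD : ∀ k, k + 1 ≤ n → ¬ up t α k → ¬ up t α (k + 1) →
        ∑ y ∈ O, chi t α (xel t α (k + 1)) y = f (k + 1) - f k := by
      intro k hk hu hu'
      rw [hf, ← Finset.sum_sub_distrib]
      refine Finset.sum_congr rfl fun y _ => ?_
      have := H_down hF hodd y hu
      simp only [chi, hh, maxIn_iff_s12 hF y hk]
      by_cases h1 : H t α y (k + 1) <;> by_cases h2 : H t α y k <;>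
        first
        | exact absurd (this h2) h1
        | exact absurd (this h1) h2
        | simp [hu, hu', h1, h2]
    have cD' : ∀ k, k + 1 ≤ n → ¬ up t α k → ¬ up t α (k + 1) →
        ∑ y ∈ O, chi t α (xel t α (k + 1)) y = f (k + 2) - f (k + 1) := by
      intro k hk hu hu'
      rw [hrho, hf, ← Finset.sum_sub_distrib]
      refine Finset.sum_congr rfl fun y _ => ?_
      have := H_down hF hodd y hu'
      simp only [hh, minOut_iff_s12 hF hodd y hk]
      by_cases h1 : H t α y (k + 1) <;> by_cases h2 : H t α y (k + 2) <;>
        first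
        | exact absurd (this h2) h1
        | exact absurd (this h1) h2
        | simp [hu, hu', h1, h2]
    have cP : ∀ k, k + 1 ≤ n → up t α k → ¬ up t α (k + 1) →
        ∑ y ∈ O, chi t α (xel t α (k + 1)) y = f (k + 1) := by
      intro k hk hu hu'
      refine Finset.sum_congr rfl fun y _ => ?_
      simp only [chi, hh, maxIn_iff_s12 hF y hk]
      simp [hu, hu']
    have cV : ∀ k, k + 1 ≤ n → ¬ up t α k → up t α (k + 1) →
        ∑ y ∈ O, chi t α (xel t α (k + 1)) y = N - f (k + 1) := by
      intro k hk hu hu'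
      rw [hrho, hf, ← hcard, ← Finset.sum_sub_distrib]
      refine Finset.sum_congr rfl fun y _ => ?_
      simp only [hh, minOut_iff_s12 hF hodd y hk]
      by_cases h1 : H t α y (k + 1) <;> simp [hu, hu', h1]
    have second : ∀ k, k + 1 ≤ n → (up t α k ↔ up t α (k + 1)) →
        2 * f (k + 1) = f k + f (k + 2) := by
      intro k hk hu
      by_cases h : up t α k
      · have := cU k hk h (hu.1 h)
        have := cU' k hk h (hu.1 h)
        linarith
      · have h' : ¬ up t α (k + 1) := fun h'' => h (hu.2 h'')
        have := cD k hk h h'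
        have := cD' k hk h h'
        linarith
    have shared : ∀ i, i ≤ t → f (m α i) + f (n + 1 - m α i) = N := by
      intro i hi
      have hs := m_sym hpal i hi
      rcases Nat.eq_zero_or_pos i with rfl | hi0
      · simp [m, f0, fn]
      rcases eq_or_lt_of_le hi with rfl | hit
      · rw [hm]; simp [f0, fn]
      have h := hmes i hi0 (by omega) x
      have e1 : 1 ≤ m α i := by
        have := m_mono α hi0
        have h5 : m α (0 + 1) = α 0 := by simp [m]
        have := hF.2.2.1
        rw [Nat.succ_eq_add_one] at *
        omega
      have e2 : 1 ≤ m α (t - i) := by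
        have := m_mono α (show 0 + 1 ≤ t - i by omega)
        have h5 : m α (0 + 1) = α 0 := by simp [m]
        have := hF.2.2.1
        omega
      rw [hconv, Finset.sum_add_distrib, sElx, sElx, ← hh_eq e1 (by omega),
        ← hh_eq e2 (by omega), mul_one] at h
      rw [show n + 1 - m α i = m α (t - i) by omega]
      exact h
    have gN : ∀ k, k ≤ n + 1 → f k + f (n + 1 - k) = N := by
      intro k hk
      rcases eq_or_lt_of_le hk with rfl | hk
      · simp [f0, fn]
      obtain ⟨i, hi, h1, h2⟩ := seg_exists α t k (by omega)
      have hle := m_mono α (show i + 1 ≤ t from hi)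
      have := affine_const (fun k => f k + f (n + 1 - k)) (m α i) (m α (i + 1) - m α i) N
        (shared i (by omega))
        (by rw [show m α i + (m α (i + 1) - m α i) = m α (i + 1) by omega]
            exact shared (i + 1) hi)
        (by
          intro j hj
          have hu1 := up_iff (t := t) (α := α) (k := m α i + j) hi (by omega) (by omega)
          have hu2 := up_iff (t := t) (α := α) (k := m α i + j + 1) hi (by omega) (by omega)
          have s1 := second (m α i + j) (by omega) (hu1.trans hu2.symm)
          obtain ⟨l, hl⟩ : ∃ l, m α i + j + 1 + l = n := ⟨n - (m α i + j + 1), by omega⟩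
          have v1 := up_sym hF hodd hpal (k := m α i + j + 1) (l := l) hl
          have v2 := up_sym hF hodd hpal (k := m α i + j) (l := l + 1) (by omega)
          have s2 := second l (by omega)
            (v1.trans (hu2.trans (hu1.symm.trans v2.symm)))
          rw [show n + 1 - (m α i + j + 1) = l + 1 by omega,
            show n + 1 - (m α i + j) = l + 2 by omega,
            show n + 1 - (m α i + j + 2) = l by omega]
          linarith)
        (k - m α i) (by omega)
      rw [show m α i + (k - m α i) = k by omega] at this
      exact this
    constructor
    · intro k hk1 hk2
      rw [hconv, Finset.sum_add_distrib, ← hh_eq hk1 hk2, ← hh_eq (by omega) (by omega)]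
      have := gN k (by omega)
      rw [show n + 1 - k = n - k + 1 by omega] at this
      exact this
    · intro k hk1 hk2
      rw [hconv, Finset.sum_sub_distrib]
      obtain ⟨j, rfl⟩ : ∃ j, k = j + 1 := ⟨k - 1, by omega⟩
      obtain ⟨l, hl⟩ : ∃ l, j + 1 + l = n := ⟨n - (j + 1), by omega⟩
      rw [show n - (j + 1) + 1 = l + 1 by omega]
      have v1 := up_sym hF hodd hpal (k := j + 1) (l := l) hl
      have v2 := up_sym hF hodd hpal (k := j) (l := l + 1) (by omega)
      have g0 := gN j (by omega)
      have g1 := gN (j + 1) (by omega)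
      have g2 := gN (j + 2) (by omega)
      rw [show n + 1 - j = l + 2 by omega] at g0
      rw [show n + 1 - (j + 1) = l + 1 by omega] at g1
      rw [show n + 1 - (j + 2) = l by omega] at g2
      by_cases u1 : up t α j <;> by_cases u2 : up t α (j + 1)
      · rw [cU j hk2 u1 u2, cU' l (by omega) (v1.2 u2) (v2.2 u1)]
        linarith
      · rw [cP j hk2 u1 u2, cV l (by omega) (fun h => u2 (v1.1 h)) (v2.2 u1)]
        linarith
      · rw [cV j hk2 u1 u2, cP l (by omega) (v1.2 u2) (fun h => u1 (v2.1 h))]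
        linarith
      · rw [cD j hk2 u1 u2, cD' l (by omega) (fun h => u2 (v1.1 h)) (fun h => u1 (v2.1 h))]
        linarith
  constructor
  · intro k h1 h2 x
    rw [mul_one]; exact (main x).1 k h1 h2
  · intro k h1 h2 x
    rw [mul_zero]; exact (main x).2 k h1 h2

end Fence
end
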